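/- Suppose |V| = |R × S| and K_1 is invertible, and set r = (μ_p + ν_p) · ‖𝒦_1‖_p. Then for every j ≥ 2, the multilinear operator norm of the inverse Born operator satisfies ‖𝒦_j‖_p ≤ ‖𝒦_1‖_p · r^j · 2^j · (max{1, r})^{j(j−1)/2}. -/

import Mathlib

open scoped ENNReal

/-- The ℓ^p norm of a finitely indexed family, `p ∈ [1, ∞]`. -/
noncomputable def lpNorm (p : ℝ≥0∞) {ι E : Type*} [Fintype ι] [SeminormedAddCommGroup E]
    (f : ι → E) : ℝ :=
  if p = ∞ then ⨆ i, ‖f i‖ else (∑ i, ‖f i‖ ^ p.toReal) ^ (1 / p.toReal)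

variable {V R S : Type*} [Fintype V] [DecidableEq V] [Fintype R] [Fintype S]

/-- The multilinear forward Born operator: `bornK α0 B G C j` is `K_j`, mapping
`(η_1, …, η_j)` (given as the first `j` values of an `ℕ`-indexed family) to
`(r, s) ↦ (−α0)^j (B D_{η_1} G D_{η_2} G ⋯ G D_{η_j} C)(r, s)`; `K_0 := 0` is junk. -/
noncomputable def bornK (α0 : ℝ) (B : Matrix R V ℂ) (G : Matrix V V ℂ) (C : Matrix V S ℂ) :
    ℕ → (ℕ → V → ℂ) → R × S → ℂ
  | 0, _ => 0
  | j + 1, η => fun rs =>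
      (-(α0 : ℂ)) ^ (j + 1) *
        (B * Matrix.diagonal (η 0) *
          (List.ofFn fun i : Fin j => G * Matrix.diagonal (η (i.1 + 1))).prod * C) rs.1 rs.2

/-- `μ_p = α0 · max_{v ∈ V} ‖row v of G‖_{ℓ^q}` (this depends only on `q`). -/
noncomputable def muConst (α0 : ℝ) (q : ℝ≥0∞) (G : Matrix V V ℂ) : ℝ :=
  α0 * ⨆ v : V, lpNorm q (G v)

/-- `ν_p = α0 · (Σ_{r ∈ R} ‖row r of B‖_q^p)^{1/p} · (Σ_{s ∈ S} ‖column s of C‖_q^p)^{1/p}`,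
with maxima replacing sums when `p = ∞`. -/
noncomputable def nuConst (α0 : ℝ) (p q : ℝ≥0∞) (B : Matrix R V ℂ) (C : Matrix V S ℂ) : ℝ :=
  α0 * lpNorm p (fun r : R => lpNorm q (B r)) * lpNorm p (fun s : S => lpNorm q fun v => C v s)

/-- `C_p = min_{‖η‖_p = 1} ‖K_1 η‖_p`. -/
noncomputable def CpConst (p : ℝ≥0∞) (α0 : ℝ) (B : Matrix R V ℂ) (G : Matrix V V ℂ)
    (C : Matrix V S ℂ) : ℝ :=
  sInf {t : ℝ | ∃ η : V → ℂ, lpNorm p η = 1 ∧ t = lpNorm p (bornK α0 B G C 1 fun _ => η)}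

/-- Block application for the tensor sum over compositions: given a composition `c` of `j`
and arguments `x : (ℂ^V)^j` (as an `ℕ`-indexed family), `blockK c x` is the `m`-tuple
`(K_{i_1} ⊗ ⋯ ⊗ K_{i_m})(x_1, …, x_j)`, where `m = c.length`, `i_k = c.blocksFun k`, and the
`k`-th component applies `K_{i_k}` to the consecutive block of arguments of size `i_k`. -/
noncomputable def blockK (α0 : ℝ) (B : Matrix R V ℂ) (G : Matrix V V ℂ) (C : Matrix V S ℂ)
    {j : ℕ} (c : Composition j) (x : ℕ → V → ℂ) : ℕ → R × S → ℂ :=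
  fun k =>
    if h : k < c.length then
      bornK α0 B G C (c.blocksFun ⟨k, h⟩) (fun i => x (c.sizeUpTo k + i))
    else 0

/-- The multilinear inverse Born operators: `bornKinv α0 B G C 𝒦₁ j` is `𝒦_j`, where
`𝒦_1 = 𝒦₁` (intended to be `K_1⁻¹`) and, for `j ≥ 2`,
`𝒦_j = −(Σ_{m=1}^{j−1} 𝒦_m ∘ (Σ_{i_1+⋯+i_m=j, i_k ≥ 1} K_{i_1} ⊗ ⋯ ⊗ K_{i_m})) ∘ (𝒦_1 ⊗ ⋯ ⊗ 𝒦_1)`;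
the inner sum over `m` and over `(i_1, …, i_m)` is the sum over all compositions `c` of `j`
with `c.length = m < j`. `𝒦_0 := 0` is junk. -/
noncomputable def bornKinv (α0 : ℝ) (B : Matrix R V ℂ) (G : Matrix V V ℂ) (C : Matrix V S ℂ)
    (K1inv : (R × S → ℂ) → V → ℂ) : ℕ → (ℕ → R × S → ℂ) → V → ℂ
  | 0 => fun _ => 0
  | 1 => fun x => K1inv (x 0)
  | j + 2 => fun x =>
      -∑ c : Composition (j + 2),
        if h : c.length < j + 2 then
          bornKinv α0 B G C K1inv c.length (blockK α0 B G C c fun i => K1inv (x i))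
        else 0
  termination_by j => j
  decreasing_by exact h

/-- The multilinear operator norm `‖T‖_p` of a `j`-multilinear map `T` (taking its arguments
as an `ℕ`-indexed family, only the first `j` of which matter): the smallest constant `t` with
`‖T(x_1, …, x_j)‖_p ≤ t ∏_{i=1}^j ‖x_i‖_p` for all `x`. -/
noncomputable def mulNorm (p : ℝ≥0∞) (j : ℕ) (T : (ℕ → R × S → ℂ) → V → ℂ) : ℝ :=
  sInf {t : ℝ | ∀ x : ℕ → R × S → ℂ, lpNorm p (T x) ≤ t * ∏ i ∈ Finset.range j, lpNorm p (x i)}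

theorem lpNorm_eq {ι E : Type*} [Fintype ι] [SeminormedAddCommGroup E] (p : ℝ≥0∞) (hp : 1 ≤ p)
    (f : ι → E) : lpNorm p f = ‖(WithLp.toLp p f : PiLp p (fun _ : ι => E))‖ := by
  unfold lpNorm
  split_ifs with h
  · subst h
    rw [PiLp.norm_eq_ciSup]
  · rw [PiLp.norm_eq_sum]
    exact ENNReal.toReal_pos (by rintro rfl; simp at hp) h

theorem lpNorm_nonneg' {ι E : Type*} [Fintype ι] [SeminormedAddCommGroup E] (p : ℝ≥0∞)
    (f : ι → E) : 0 ≤ lpNorm p f := by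
  unfold lpNorm
  split_ifs with h
  · exact Real.iSup_nonneg fun i => norm_nonneg _
  · positivity

theorem lpNorm_mono {ι E F : Type*} [Fintype ι] [SeminormedAddCommGroup E]
    [SeminormedAddCommGroup F] (p : ℝ≥0∞) (f : ι → E) (g : ι → F) (h : ∀ i, ‖f i‖ ≤ ‖g i‖) :
    lpNorm p f ≤ lpNorm p g := by
  unfold lpNorm
  split_ifs with hp
  · exact ciSup_mono (Set.finite_range _).bddAbove h
  · gcongr with i
    exact h i

theorem lpNorm_const_mul {ι : Type*} [Fintype ι] (p : ℝ≥0∞) (hp : 1 ≤ p) (c : ℝ) (hc : 0 ≤ c)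
    (f : ι → ℝ) : lpNorm p (fun i => c * f i) = c * lpNorm p f := by
  have : Fact (1 ≤ p) := ⟨hp⟩
  rw [lpNorm_eq p hp, lpNorm_eq p hp]
  have : (WithLp.toLp p (fun i => c * f i) : PiLp p (fun _ : ι => ℝ)) = c • WithLp.toLp p f := by
    ext i; simp
  rw [this, norm_smul, Real.norm_of_nonneg hc]

theorem lpNorm_neg' {ι : Type*} [Fintype ι] (p : ℝ≥0∞) (f : ι → ℂ) :
    lpNorm p (-f) = lpNorm p f := by
  simp [lpNorm]

theorem lpNorm_zero' {ι : Type*} [Fintype ι] (p : ℝ≥0∞) (hp : 1 ≤ p) :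
    lpNorm p (0 : ι → ℂ) = 0 := by
  have : Fact (1 ≤ p) := ⟨hp⟩
  rw [lpNorm_eq p hp]; simp

theorem lpNorm_sum {ι κ : Type*} [Fintype ι] (p : ℝ≥0∞) (hp : 1 ≤ p) (s : Finset κ)
    (f : κ → ι → ℂ) : lpNorm p (∑ k ∈ s, f k) ≤ ∑ k ∈ s, lpNorm p (f k) := by
  have : Fact (1 ≤ p) := ⟨hp⟩
  simp only [lpNorm_eq p hp]
  rw [WithLp.toLp_sum]
  exact norm_sum_le _ _

theorem norm_le_lpNorm {ι E : Type*} [Fintype ι] [SeminormedAddCommGroup E] (p : ℝ≥0∞)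
    (hp : 1 ≤ p) (f : ι → E) (i : ι) : ‖f i‖ ≤ lpNorm p f := by
  have : Fact (1 ≤ p) := ⟨hp⟩
  rw [lpNorm_eq p hp]
  exact PiLp.norm_apply_le (WithLp.toLp p f : PiLp p (fun _ : ι => E)) i

theorem lpNorm_prod_le {ι κ : Type*} [Fintype ι] [Fintype κ] [Nonempty ι] [Nonempty κ]
    (p : ℝ≥0∞) (hp : 1 ≤ p)
    (a : ι → ℝ) (b : κ → ℝ) :
    lpNorm p (fun x : ι × κ => a x.1 * b x.2) ≤ lpNorm p a * lpNorm p b := by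
  by_cases h : p = ∞
  · conv_lhs => rw [lpNorm, if_pos h]
    refine ciSup_le fun x => ?_
    rw [norm_mul]
    exact mul_le_mul (norm_le_lpNorm p hp a _) (norm_le_lpNorm p hp b _) (norm_nonneg _)
      (lpNorm_nonneg' p a)
  · simp only [lpNorm, if_neg h]
    rw [← Real.mul_rpow (by positivity) (by positivity), Finset.sum_mul_sum,
      Fintype.sum_prod_type]
    simp_rw [norm_mul, Real.mul_rpow (norm_nonneg _) (norm_nonneg _)]
    exact le_rfl

theorem lp_holder {ι : Type*} [Fintype ι] (p q : ℝ≥0∞) (hp : 1 ≤ p) (hq : 1 ≤ q)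
    (hpq : 1 / p + 1 / q = 1) (f g : ι → ℂ) :
    ∑ i, ‖f i‖ * ‖g i‖ ≤ lpNorm q f * lpNorm p g := by
  by_cases h : p = ∞
  · have hq1 : q = 1 := by simpa [h] using hpq
    have e : lpNorm q f = ∑ i, ‖f i‖ := by simp [lpNorm, hq1]
    rw [e, Finset.sum_mul]
    gcongr with i
    exact norm_le_lpNorm p hp g i
  by_cases h' : q = ∞
  · have hp1 : p = 1 := by simpa [h'] using hpq
    have e : lpNorm p g = ∑ i, ‖g i‖ := by simp [lpNorm, hp1]
    rw [e, Finset.mul_sum]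
    gcongr with i
    exact norm_le_lpNorm q hq f i
  have : ENNReal.HolderConjugate q p := by
    rw [ENNReal.holderConjugate_iff]
    simpa [add_comm] using hpq
  simp only [lpNorm, if_neg h, if_neg h']
  exact Real.inner_le_Lp_mul_Lq_of_nonneg _ (ENNReal.HolderConjugate.toReal_of_ne_top h' h)
    (fun _ _ => norm_nonneg _) (fun _ _ => norm_nonneg _)

theorem holder3 {ι : Type*} [Fintype ι] (p q : ℝ≥0∞) (hp : 1 ≤ p) (hq : 1 ≤ q)
    (hpq : 1 / p + 1 / q = 1) (a η f : ι → ℂ) (M : ℝ) (hM : 0 ≤ M) (hf : ∀ i, ‖f i‖ ≤ M) :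
    ‖∑ i, a i * η i * f i‖ ≤ lpNorm q a * lpNorm p η * M := by
  calc ‖∑ i, a i * η i * f i‖ ≤ ∑ i, ‖a i * η i * f i‖ := norm_sum_le _ _
    _ ≤ ∑ i, ‖a i‖ * ‖η i‖ * M := by
        gcongr with i
        rw [norm_mul, norm_mul]
        gcongr
        exact hf i
    _ ≤ _ := by
        rw [← Finset.sum_mul]
        gcongr
        exact lp_holder p q hp hq hpq a η

theorem chain_bound (p q : ℝ≥0∞) (hp : 1 ≤ p) (hq : 1 ≤ q)
    (hpq : 1 / p + 1 / q = 1) (G : Matrix V V ℂ) (C : Matrix V S ℂ) (s : S) (g cs : ℝ)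
    (hg0 : 0 ≤ g) (hg : ∀ v, lpNorm q (G v) ≤ g) (hcs : lpNorm q (fun v => C v s) = cs) (j : ℕ) :
    ∀ (η : ℕ → V → ℂ) (v : V),
    ‖((List.ofFn fun i : Fin j => G * Matrix.diagonal (η i.1)).prod * C) v s‖ ≤
      g ^ j * (∏ i ∈ Finset.range j, lpNorm p (η i)) * cs := by
  have hC : 0 ≤ cs := hcs ▸ lpNorm_nonneg' q (fun v => C v s)
  induction j with
  | zero =>
    intro η v
    rw [← hcs]
    simpa using norm_le_lpNorm q hq (fun v => C v s) v
  | succ j ih =>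
    intro η v
    have hP : 0 ≤ ∏ i ∈ Finset.range j, lpNorm p (η (i + 1)) :=
      Finset.prod_nonneg fun i _ => lpNorm_nonneg' _ _
    have e : ((List.ofFn fun i : Fin (j + 1) => G * Matrix.diagonal (η i.1)).prod * C) v s =
        ∑ w, G v w * η 0 w *
          ((List.ofFn fun i : Fin j => G * Matrix.diagonal (η (i.1 + 1))).prod * C) w s := by
      rw [List.ofFn_succ, List.prod_cons, Matrix.mul_assoc, Matrix.mul_apply]
      simp only [Matrix.mul_diagonal, Fin.val_zero, Fin.val_succ]
    rw [e]
    have h3 := holder3 p q hp hq hpq (G v) (η 0) (fun w =>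
          ((List.ofFn fun i : Fin j => G * Matrix.diagonal (η (i.1 + 1))).prod * C) w s)
      (g ^ j * (∏ i ∈ Finset.range j, lpNorm p (η (i + 1))) * cs)
      (mul_nonneg (mul_nonneg (pow_nonneg hg0 j) hP) hC)
      (fun w => ih (fun i => η (i + 1)) w)
    refine h3.trans ?_
    rw [Finset.prod_range_succ', pow_succ]
    have h0 := lpNorm_nonneg' p (η 0)
    have hgv := hg v
    generalize lpNorm p (η 0) = n0 at *
    generalize (∏ i ∈ Finset.range j, lpNorm p (η (i + 1))) = P at *
    generalize lpNorm q (G v) = gv at *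
    calc gv * n0 * (g ^ j * P * cs) ≤ g * n0 * (g ^ j * P * cs) := by
          gcongr
      _ = _ := by ring

theorem bornK_bound [Nonempty R] [Nonempty S] (p q : ℝ≥0∞) (hp : 1 ≤ p) (hq : 1 ≤ q)
    (hpq : 1 / p + 1 / q = 1) (α0 : ℝ) (hα0 : 0 < α0)
    (B : Matrix R V ℂ) (G : Matrix V V ℂ) (C : Matrix V S ℂ) (j : ℕ) (η : ℕ → V → ℂ) :
    lpNorm p (bornK α0 B G C (j + 1) η) ≤
      nuConst α0 p q B C * muConst α0 q G ^ j * ∏ i ∈ Finset.range (j + 1), lpNorm p (η i) := by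
  have hg : ∀ v, lpNorm q (G v) ≤ ⨆ v : V, lpNorm q (G v) :=
    fun v => le_ciSup (f := fun v => lpNorm q (G v)) (Set.finite_range _).bddAbove v
  have hg0 : 0 ≤ ⨆ v : V, lpNorm q (G v) := Real.iSup_nonneg fun v => lpNorm_nonneg' _ _
  rw [nuConst, muConst, Finset.prod_range_succ']
  generalize (⨆ v : V, lpNorm q (G v)) = g at *
  have hP : 0 ≤ ∏ i ∈ Finset.range j, lpNorm p (η (i + 1)) :=
      Finset.prod_nonneg fun i _ => lpNorm_nonneg' _ _
  have h0 := lpNorm_nonneg' p (η 0)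
  have key : ∀ rs : R × S, ‖bornK α0 B G C (j + 1) η rs‖ ≤
      ‖(α0 ^ (j + 1) * g ^ j * ((∏ i ∈ Finset.range j, lpNorm p (η (i + 1))) *
        lpNorm p (η 0))) * (lpNorm q (B rs.1) * lpNorm q (fun v => C v rs.2))‖ := by
    intro rs
    refine le_trans ?_ (le_abs_self _)
    have hC := lpNorm_nonneg' q (fun v => C v rs.2)
    have e : bornK α0 B G C (j + 1) η rs = (-(α0 : ℂ)) ^ (j + 1) *
        ∑ w, B rs.1 w * η 0 w *
          ((List.ofFn fun i : Fin j => G * Matrix.diagonal (η (i.1 + 1))).prod * C) w rs.2 := by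
      simp only [bornK]
      rw [Matrix.mul_assoc, Matrix.mul_apply]
      simp only [Matrix.mul_diagonal]
    rw [e, norm_mul, norm_pow, norm_neg, Complex.norm_real, Real.norm_of_nonneg hα0.le]
    obtain ⟨cs, hcs⟩ : ∃ cs, lpNorm q (fun v => C v rs.2) = cs := ⟨_, rfl⟩
    rw [hcs] at hC ⊢
    have h3 := holder3 p q hp hq hpq (B rs.1) (η 0) (fun w =>
          ((List.ofFn fun i : Fin j => G * Matrix.diagonal (η (i.1 + 1))).prod * C) w rs.2)
      (g ^ j * (∏ i ∈ Finset.range j, lpNorm p (η (i + 1))) * cs)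
      (mul_nonneg (mul_nonneg (pow_nonneg hg0 j) hP) hC)
      (fun w => chain_bound p q hp hq hpq G C rs.2 g cs hg0 hg hcs j (fun i => η (i + 1)) w)
    refine (mul_le_mul_of_nonneg_left h3 (pow_nonneg hα0.le _)).trans (le_of_eq ?_)
    ring
  generalize lpNorm p (η 0) = n0 at *
  generalize (∏ i ∈ Finset.range j, lpNorm p (η (i + 1))) = P at *
  have hc0 : 0 ≤ α0 ^ (j + 1) * g ^ j * (P * n0) := by positivity
  refine (lpNorm_mono p _ _ key).trans ?_
  rw [lpNorm_const_mul p hp _ hc0]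
  refine (mul_le_mul_of_nonneg_left (lpNorm_prod_le p hp (fun r : R => lpNorm q (B r))
          (fun s : S => lpNorm q fun v => C v s)) hc0).trans (le_of_eq ?_)
  ring

theorem sum_comp_le (n : ℕ) (a b : ℝ) (ha : 0 ≤ a) (hb : 0 ≤ b) :
    ∑ c : Composition n, a ^ c.length * b ^ (n - c.length) ≤ (a + b) ^ n := by
  classical
  rw [← Fin.sum_pow_mul_eq_add_pow]
  let φ : Composition n → Finset (Fin n) := fun c =>
    Finset.univ.filter fun i => i.castSucc ∈ c.boundaries
  have hlast : ∀ c : Composition n, Fin.last n ∈ c.boundaries :=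
    fun c => c.toCompositionAsSet.getLast_mem
  have hb' : ∀ c : Composition n, c.boundaries =
      insert (Fin.last n) ((φ c).map Fin.castSuccEmb) := by
    intro c
    ext i
    refine Fin.lastCases ?_ (fun i => ?_) i
    · simp [hlast]
    · simp [φ, Fin.castSucc_ne_last]
  have hcard : ∀ c : Composition n, (φ c).card = c.length := by
    intro c
    have h := c.card_boundaries_eq_succ_length
    rw [hb' c, Finset.card_insert_of_notMem (by simp), Finset.card_map] at h
    omega
  have hinj : Function.Injective φ := by
    intro c d h
    apply (compositionEquiv n).injective
    apply CompositionAsSet.ext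
    change c.boundaries = d.boundaries
    rw [hb' c, hb' d, h]
  calc _ = ∑ c : Composition n, a ^ (φ c).card * b ^ (n - (φ c).card) := by simp [hcard]
    _ = ∑ s ∈ Finset.univ.image φ, a ^ s.card * b ^ (n - s.card) :=
        (Finset.sum_image (f := fun s : Finset (Fin n) => a ^ s.card * b ^ (n - s.card))
          fun c _ d _ h => hinj h).symm
    _ ≤ _ := Finset.sum_le_sum_of_subset_of_nonneg (Finset.subset_univ _)
        fun _ _ _ => by positivity

theorem comp_prod {n : ℕ} (c : Composition n) (f : ℕ → ℝ) :
    ∏ k : Fin c.length, ∏ i ∈ Finset.range (c.blocksFun k), f (c.sizeUpTo k + i) =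
      ∏ i ∈ Finset.range n, f i := by
  rw [Finset.prod_range, ← c.blocksFinEquiv.prod_comp, Fintype.prod_sigma]
  refine Finset.prod_congr rfl fun k _ => ?_
  rw [Finset.prod_range]
  rfl

theorem comp_weight {n : ℕ} (c : Composition n) (a b : ℝ) :
    ∏ k : Fin c.length, (a * b ^ (c.blocksFun k - 1)) = a ^ c.length * b ^ (n - c.length) := by
  rw [Finset.prod_mul_distrib, Finset.prod_pow_eq_pow_sum]
  simp only [Finset.prod_const, Finset.card_univ, Fintype.card_fin]
  congr 2
  have h1 : ∑ k : Fin c.length, (c.blocksFun k - 1 + 1) = n := by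
    refine Eq.trans ?_ c.sum_blocksFun
    refine Finset.sum_congr rfl fun k _ => ?_
    have := c.one_le_blocksFun k
    omega
  rw [Finset.sum_add_distrib] at h1
  simp at h1
  omega

theorem muConst_nonneg (α0 : ℝ) (hα0 : 0 < α0) (q : ℝ≥0∞) (G : Matrix V V ℂ) :
    0 ≤ muConst α0 q G :=
  mul_nonneg hα0.le (Real.iSup_nonneg fun v => lpNorm_nonneg' _ _)

theorem nuConst_nonneg (α0 : ℝ) (hα0 : 0 < α0) (p q : ℝ≥0∞) (B : Matrix R V ℂ)
    (C : Matrix V S ℂ) : 0 ≤ nuConst α0 p q B C :=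
  mul_nonneg (mul_nonneg hα0.le (lpNorm_nonneg' _ _)) (lpNorm_nonneg' _ _)

theorem lpNorm_one_pos {ι : Type*} [Fintype ι] [Nonempty ι] (p : ℝ≥0∞) (hp : 1 ≤ p) :
    0 < lpNorm p (fun _ : ι => (1 : ℂ)) := by
  refine lt_of_lt_of_le one_pos ?_
  simpa using norm_le_lpNorm p hp (fun _ : ι => (1 : ℂ)) (Classical.arbitrary ι)

theorem mulNorm_mem_nonneg [Nonempty R] [Nonempty S] (p : ℝ≥0∞) (hp : 1 ≤ p) (j : ℕ)
    (T : (ℕ → R × S → ℂ) → V → ℂ) (t : ℝ)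
    (ht : ∀ x : ℕ → R × S → ℂ, lpNorm p (T x) ≤ t * ∏ i ∈ Finset.range j, lpNorm p (x i)) :
    0 ≤ t := by
  have h := (lpNorm_nonneg' p _).trans (ht fun _ _ => 1)
  refine nonneg_of_mul_nonneg_left h (Finset.prod_pos fun i _ => lpNorm_one_pos p hp)

theorem mulNorm_le [Nonempty R] [Nonempty S] (p : ℝ≥0∞) (hp : 1 ≤ p) (j : ℕ)
    (T : (ℕ → R × S → ℂ) → V → ℂ) (t : ℝ)
    (ht : ∀ x : ℕ → R × S → ℂ, lpNorm p (T x) ≤ t * ∏ i ∈ Finset.range j, lpNorm p (x i)) :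
    mulNorm p j T ≤ t :=
  csInf_le ⟨0, fun t ht => mulNorm_mem_nonneg p hp j T t ht⟩ ht

theorem mulNorm_nonneg [Nonempty R] [Nonempty S] (p : ℝ≥0∞) (hp : 1 ≤ p) (j : ℕ)
    (T : (ℕ → R × S → ℂ) → V → ℂ) : 0 ≤ mulNorm p j T :=
  Real.sInf_nonneg fun t ht => mulNorm_mem_nonneg p hp j T t ht

theorem le_mulNorm [Nonempty R] [Nonempty S] (p : ℝ≥0∞) (j : ℕ)
    (T : (ℕ → R × S → ℂ) → V → ℂ) (t : ℝ)
    (ht : ∀ x : ℕ → R × S → ℂ, lpNorm p (T x) ≤ t * ∏ i ∈ Finset.range j, lpNorm p (x i))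
    (x : ℕ → R × S → ℂ) :
    lpNorm p (T x) ≤ mulNorm p j T * ∏ i ∈ Finset.range j, lpNorm p (x i) := by
  have h0 : 0 ≤ ∏ i ∈ Finset.range j, lpNorm p (x i) :=
    Finset.prod_nonneg fun i _ => lpNorm_nonneg' _ _
  rcases h0.eq_or_lt with h | h
  · have := ht x
    rw [← h] at this ⊢
    simpa using this
  · rw [← div_le_iff₀ h]
    refine le_csInf ⟨t, ht⟩ fun s hs => ?_
    rw [div_le_iff₀ h]
    exact hs x

theorem K1inv_bdd (p : ℝ≥0∞) (hp : 1 ≤ p)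
    (α0 : ℝ) (B : Matrix R V ℂ) (G : Matrix V V ℂ) (C : Matrix V S ℂ)
    (K1inv : (R × S → ℂ) → V → ℂ)
    (hleft : ∀ η : V → ℂ, K1inv (bornK α0 B G C 1 fun _ => η) = η)
    (hright : ∀ φ : R × S → ℂ, bornK α0 B G C 1 (fun _ => K1inv φ) = φ) :
    ∃ t : ℝ, ∀ φ, lpNorm p (K1inv φ) ≤ t * lpNorm p φ := by
  have : Fact (1 ≤ p) := ⟨hp⟩
  let L : (V → ℂ) ≃ₗ[ℂ] (R × S → ℂ) :=
    { toFun := fun η => bornK α0 B G C 1 fun _ => η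
      invFun := K1inv
      left_inv := hleft
      right_inv := hright
      map_add' := by
        intro x y
        ext rs
        simp only [bornK, Pi.add_apply]
        have : Matrix.diagonal (x + y) = Matrix.diagonal x + Matrix.diagonal y :=
          (Matrix.diagonal_add x y).symm
        rw [this]
        simp only [Matrix.mul_add, Matrix.add_mul, Matrix.add_apply, mul_add, List.ofFn_zero, List.prod_nil]
      map_smul' := by
        intro c x
        ext rs
        simp only [bornK, Pi.smul_apply]
        rw [Matrix.diagonal_smul]
        simp
        ring }
  let T : PiLp p (fun _ : R × S => ℂ) →ₗ[ℂ] PiLp p (fun _ : V => ℂ) :=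
    (WithLp.linearEquiv p ℂ (V → ℂ)).symm.toLinearMap ∘ₗ L.symm.toLinearMap ∘ₗ
      (WithLp.linearEquiv p ℂ (R × S → ℂ)).toLinearMap
  refine ⟨‖LinearMap.toContinuousLinearMap T‖, fun φ => ?_⟩
  rw [lpNorm_eq p hp, lpNorm_eq p hp]
  exact (LinearMap.toContinuousLinearMap T).le_opNorm (WithLp.toLp p φ)

theorem blockK_prod [Nonempty V] [Nonempty R] [Nonempty S] (p q : ℝ≥0∞) (hp : 1 ≤ p) (hq : 1 ≤ q)
    (hpq : 1 / p + 1 / q = 1) (α0 : ℝ) (hα0 : 0 < α0)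
    (B : Matrix R V ℂ) (G : Matrix V V ℂ) (C : Matrix V S ℂ) {n : ℕ} (c : Composition n)
    (x : ℕ → V → ℂ) :
    ∏ k ∈ Finset.range c.length, lpNorm p (blockK α0 B G C c x k) ≤
      nuConst α0 p q B C ^ c.length * muConst α0 q G ^ (n - c.length) *
        ∏ i ∈ Finset.range n, lpNorm p (x i) := by
  rw [← comp_prod c fun i => lpNorm p (x i), ← comp_weight, ← Finset.prod_mul_distrib,
    Finset.prod_range]
  refine Finset.prod_le_prod (fun k _ => lpNorm_nonneg' _ _) fun k _ => ?_
  have h : blockK α0 B G C c x k =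
      bornK α0 B G C (c.blocksFun k) (fun i => x (c.sizeUpTo k + i)) := by
    simp [blockK]
  rw [h]
  obtain ⟨m, hm⟩ : ∃ m, c.blocksFun k = m + 1 :=
    ⟨c.blocksFun k - 1, by have := c.one_le_blocksFun k; omega⟩
  rw [hm]
  exact bornK_bound p q hp hq hpq α0 hα0 B G C m _

theorem step_bound [Nonempty V] [Nonempty R] [Nonempty S] (p q : ℝ≥0∞) (hp : 1 ≤ p) (hq : 1 ≤ q)
    (hpq : 1 / p + 1 / q = 1) (α0 : ℝ) (hα0 : 0 < α0)
    (B : Matrix R V ℂ) (G : Matrix V V ℂ) (C : Matrix V S ℂ)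
    (K1inv : (R × S → ℂ) → V → ℂ) (k : ℝ) (hk : 0 ≤ k)
    (hK : ∀ φ, lpNorm p (K1inv φ) ≤ k * lpNorm p φ) (n : ℕ) (A : ℝ) (hA : 0 ≤ A)
    (ih : ∀ m, 1 ≤ m → m < n + 2 → ∀ x, lpNorm p (bornKinv α0 B G C K1inv m x) ≤
      A * ∏ i ∈ Finset.range m, lpNorm p (x i)) (x : ℕ → R × S → ℂ) :
    lpNorm p (bornKinv α0 B G C K1inv (n + 2) x) ≤
      A * ((muConst α0 q G + nuConst α0 p q B C) * k) ^ (n + 2) *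
        ∏ i ∈ Finset.range (n + 2), lpNorm p (x i) := by
  have hμ := muConst_nonneg α0 hα0 q G
  have hν := nuConst_nonneg α0 hα0 p q B C
  set μ := muConst α0 q G
  set ν := nuConst α0 p q B C
  have hP : 0 ≤ ∏ i ∈ Finset.range (n + 2), lpNorm p (x i) :=
    Finset.prod_nonneg fun i _ => lpNorm_nonneg' _ _
  rw [bornKinv, lpNorm_neg']
  refine (lpNorm_sum p hp _ _).trans ?_
  have key : ∀ c : Composition (n + 2), lpNorm p (if h : c.length < n + 2 then
          bornKinv α0 B G C K1inv c.length (blockK α0 B G C c fun i => K1inv (x i))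
        else 0) ≤ (ν ^ c.length * μ ^ (n + 2 - c.length)) *
          (A * (k ^ (n + 2) * ∏ i ∈ Finset.range (n + 2), lpNorm p (x i))) := by
    intro c
    split_ifs with h
    · refine (ih _ (c.length_pos_of_pos (by omega)) h _).trans ?_
      have h1 := blockK_prod p q hp hq hpq α0 hα0 B G C c fun i => K1inv (x i)
      have h2 : ∏ i ∈ Finset.range (n + 2), lpNorm p (K1inv (x i)) ≤
          k ^ (n + 2) * ∏ i ∈ Finset.range (n + 2), lpNorm p (x i) := by
        calc _ ≤ ∏ i ∈ Finset.range (n + 2), (k * lpNorm p (x i)) :=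
              Finset.prod_le_prod (fun i _ => lpNorm_nonneg' _ _) fun i _ => hK _
          _ = _ := by rw [Finset.prod_mul_distrib]; simp
      calc _ ≤ A * (ν ^ c.length * μ ^ (n + 2 - c.length) *
            (k ^ (n + 2) * ∏ i ∈ Finset.range (n + 2), lpNorm p (x i))) := by
            refine mul_le_mul_of_nonneg_left (h1.trans ?_) hA
            exact mul_le_mul_of_nonneg_left h2 (by positivity)
        _ = _ := by ring
    · rw [lpNorm_zero' p hp]
      positivity
  refine (Finset.sum_le_sum fun c _ => key c).trans ?_
  rw [← Finset.sum_mul]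
  refine (mul_le_mul_of_nonneg_right (sum_comp_le (n + 2) ν μ hν hμ) (by positivity)).trans ?_
  rw [mul_pow, add_comm ν μ]
  apply le_of_eq
  ring

/- STATEMENT 14: With `r = (μ_p + ν_p) ‖𝒦_1‖_p`, for every `j ≥ 2`,
`‖𝒦_j‖_p ≤ ‖𝒦_1‖_p · r^j · 2^j · (max{1, r})^{j(j−1)/2}`. -/
theorem inverse_born_operator_norm_growth [Nonempty V] [Nonempty R] [Nonempty S]
    (p q : ℝ≥0∞) (hp : 1 ≤ p) (hq : 1 ≤ q) (hpq : 1 / p + 1 / q = 1)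
    (α0 : ℝ) (hα0 : 0 < α0) (B : Matrix R V ℂ) (G : Matrix V V ℂ) (C : Matrix V S ℂ)
    (hcard : Fintype.card V = Fintype.card (R × S))
    (K1inv : (R × S → ℂ) → V → ℂ)
    (hleft : ∀ η : V → ℂ, K1inv (bornK α0 B G C 1 fun _ => η) = η)
    (hright : ∀ φ : R × S → ℂ, bornK α0 B G C 1 (fun _ => K1inv φ) = φ)
    (r : ℝ)
    (hr : r = (muConst α0 q G + nuConst α0 p q B C) * mulNorm p 1 (bornKinv α0 B G C K1inv 1))
    (j : ℕ) (hj : 2 ≤ j) :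
    mulNorm p j (bornKinv α0 B G C K1inv j) ≤
      mulNorm p 1 (bornKinv α0 B G C K1inv 1) * r ^ j * 2 ^ j *
        max 1 r ^ (j * (j - 1) / 2) := by
  have hμ := muConst_nonneg α0 hα0 q G
  have hν := nuConst_nonneg α0 hα0 p q B C
  obtain ⟨t, ht⟩ := K1inv_bdd p hp α0 B G C K1inv hleft hright
  set k := mulNorm p 1 (bornKinv α0 B G C K1inv 1) with hkdef
  have hk : 0 ≤ k := mulNorm_nonneg p hp 1 _
  have hK : ∀ φ, lpNorm p (K1inv φ) ≤ k * lpNorm p φ := by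
    intro φ
    have := le_mulNorm p 1 (bornKinv α0 B G C K1inv 1) t
      (fun x => by simpa [bornKinv] using ht (x 0)) (fun _ => φ)
    rw [← hkdef] at this
    simpa [bornKinv] using this
  have hr0 : 0 ≤ r := by rw [hr]; positivity
  have hM1 : 1 ≤ max 1 r := le_max_left _ _
  have hMr : r ≤ max 1 r := le_max_right _ _
  set M := max 1 r
  have tri : ∀ n : ℕ, (n + 2) * (n + 2 - 1) / 2 + (n + 2) = (n + 2) * (n + 2 + 1) / 2 := by
    intro n
    have : (n + 2) * (n + 2 + 1) = (n + 2) * (n + 2 - 1) + (n + 2) * 2 := by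
      rw [← mul_add]; congr 1
    rw [this, Nat.add_mul_div_right _ _ (by norm_num)]
  have mono : ∀ m n : ℕ, m < n + 2 → m * (m + 1) / 2 ≤ (n + 2) * (n + 2 - 1) / 2 := by
    intro m n h
    apply Nat.div_le_div_right
    rw [mul_comm]
    exact Nat.mul_le_mul (by omega) (by omega)
  have main : ∀ n : ℕ, (∀ m, 1 ≤ m → m < n + 2 → ∀ x, lpNorm p (bornKinv α0 B G C K1inv m x) ≤
      k * M ^ (m * (m + 1) / 2) * ∏ i ∈ Finset.range m, lpNorm p (x i)) →
      ∀ x, lpNorm p (bornKinv α0 B G C K1inv (n + 2) x) ≤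
      k * M ^ ((n + 2) * (n + 2 - 1) / 2) * r ^ (n + 2) *
        ∏ i ∈ Finset.range (n + 2), lpNorm p (x i) := by
    intro n ih x
    rw [hr]
    refine step_bound p q hp hq hpq α0 hα0 B G C K1inv k hk hK n _ (by positivity) ?_ x
    intro m hm1 hm y
    refine (ih m hm1 hm y).trans ?_
    have : 0 ≤ ∏ i ∈ Finset.range m, lpNorm p (y i) :=
      Finset.prod_nonneg fun i _ => lpNorm_nonneg' _ _
    exact mul_le_mul_of_nonneg_right (mul_le_mul_of_nonneg_left
      (pow_le_pow_right₀ hM1 (mono m n hm)) hk) this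
  have all : ∀ m, 1 ≤ m → ∀ x, lpNorm p (bornKinv α0 B G C K1inv m x) ≤
      k * M ^ (m * (m + 1) / 2) * ∏ i ∈ Finset.range m, lpNorm p (x i) := by
    intro m
    induction m using Nat.strong_induction_on with
    | _ m ih =>
      intro hm x
      have hP : ∀ m, 0 ≤ ∏ i ∈ Finset.range m, lpNorm p (x i) := fun m =>
        Finset.prod_nonneg fun i _ => lpNorm_nonneg' _ _
      match m, hm with
      | 1, _ =>
        have h1 := hK (x 0)
        have h2 := lpNorm_nonneg' p (x 0)
        simp only [bornKinv, Finset.prod_range_one]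
        refine h1.trans ?_
        gcongr
        exact le_mul_of_one_le_right hk (one_le_pow₀ hM1)
      | n + 2, _ =>
        refine (main n (fun m h1 h2 => ih m h2 h1) x).trans ?_
        refine mul_le_mul_of_nonneg_right ?_ (hP _)
        rw [← tri n, pow_add M, ← mul_assoc]
        exact mul_le_mul_of_nonneg_left (pow_le_pow_left₀ hr0 hMr _) (by positivity)
  obtain ⟨n, rfl⟩ : ∃ n, j = n + 2 := ⟨j - 2, by omega⟩
  refine mulNorm_le p hp _ _ _ fun x => ?_
  refine (main n (fun m h1 _ => all m h1) x).trans ?_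
  have hP : 0 ≤ ∏ i ∈ Finset.range (n + 2), lpNorm p (x i) :=
    Finset.prod_nonneg fun i _ => lpNorm_nonneg' _ _
  refine mul_le_mul_of_nonneg_right ?_ hP
  have h2 : (1 : ℝ) ≤ 2 ^ (n + 2) := one_le_pow₀ (by norm_num)
  calc _ = k * r ^ (n + 2) * 1 * M ^ ((n + 2) * (n + 2 - 1) / 2) := by ring
    _ ≤ _ := by gcongr
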